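/- arXiv:2307.08521 — 2 statements merged into one kernel-verified Lean document; each statement's English description precedes it below -/
import Mathlib

section
/- There is a universal constant C₀ ≥ 1 such that the following holds for all integers d,k,μ ≥ 1, all ε > 0, all Δ > 0 and all real c ≥ 1. For every (μ,ε)-curve P of complexity at most k in ℝ^d there exists a family 𝒞 of polygonal curves of complexity at most k in ℝ^d, all of whose edge lengths are at most μ·ε + Δ/c, with |𝒞| ≤ (k·μ·(C₀·c)^d)^k, such that every (μ,ε)-curve Q of complexity at most k with d_F(P,Q) ≤ Δ admits some Q* ∈ 𝒞 with d_F(Q,Q*) ≤ Δ/c. -/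
open Set Metric Function

noncomputable section

/-- Euclidean space ℝ^d. -/
abbrev Euc (d : ℕ) := EuclideanSpace ℝ (Fin d)

/-- The polygonal curve (parametrized over `[0,1]`) obtained by concatenating the
segments between consecutive vertices `p 0, p 1, …, p n`. -/
def curveMap {d n : ℕ} (p : Fin (n + 1) → Euc d) (t : ℝ) : Euc d :=
  if h : n = 0 then p 0
  else
    (1 - (t * n - (min ⌊t * (n : ℝ)⌋₊ (n - 1) : ℕ))) • p ⟨min ⌊t * (n : ℝ)⌋₊ (n - 1), by omega⟩
      + (t * n - (min ⌊t * (n : ℝ)⌋₊ (n - 1) : ℕ)) • p ⟨min ⌊t * (n : ℝ)⌋₊ (n - 1) + 1, by omega⟩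

/-- A reparametrization: a continuous non-decreasing surjection of `[0,1]` onto itself. -/
def IsRepar (f : ℝ → ℝ) : Prop :=
  ContinuousOn f (Icc 0 1) ∧ MonotoneOn f (Icc 0 1) ∧ f '' Icc 0 1 = Icc 0 1

/-- The (continuous) Fréchet distance between two curves `[0,1] → ℝ^d`. -/
def frechetDist {d : ℕ} (P Q : ℝ → Euc d) : ℝ :=
  sInf { r : ℝ | ∃ f g : ℝ → ℝ, IsRepar f ∧ IsRepar g ∧
    ∀ t ∈ Icc (0 : ℝ) 1, dist (P (f t)) (Q (g t)) ≤ r }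

/-- The edge (segment curve) from `a` to `b`, parametrized over `[0,1]`. -/
def seg {d : ℕ} (a b : Euc d) (t : ℝ) : Euc d := (1 - t) • a + t • b

/-- The subcurve `P[s,t]` of `P`, reparametrized over `[0,1]`. -/
def subcurve {d : ℕ} (P : ℝ → Euc d) (s t : ℝ) (u : ℝ) : Euc d := P (s + u * (t - s))

/-- All edge lengths of the polygonal curve with vertices `p` are at most `Λ`. -/
def EdgeLenLe {d n : ℕ} (p : Fin (n + 1) → Euc d) (Λ : ℝ) : Prop :=
  ∀ i : Fin n, dist (p i.castSucc) (p i.succ) ≤ Λ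

/-- The vertices `p` define a `(μ,ε)`-curve: each edge length is a non-negative integer
multiple of `ε` and is at most `μ·ε`. -/
def IsMuEpsEdges {d n : ℕ} (p : Fin (n + 1) → Euc d) (μ : ℕ) (ε : ℝ) : Prop :=
  ∀ i : Fin n, (∃ m : ℕ, dist (p i.castSucc) (p i.succ) = m * ε) ∧
    dist (p i.castSucc) (p i.succ) ≤ μ * ε

/-- The `Δ`-neighbourhood of a set `A ⊆ ℝ^d`. -/
def nbhd {d : ℕ} (A : Set (Euc d)) (Δ : ℝ) : Set (Euc d) :=
  { x | ∃ a ∈ A, dist x a ≤ Δ }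


open MeasureTheory Module in
lemma packing_card {d : ℕ} (s : Finset (Euc d)) (x0 : Euc d) (K δ : ℝ) (hK : 0 ≤ K) (hδ : 0 < δ)
    (hs : ∀ c ∈ s, dist c x0 ≤ K) (h : ∀ c ∈ s, ∀ e ∈ s, c ≠ e → δ ≤ dist c e) :
    (s.card : ℝ) ≤ ((2 * K + δ) / δ) ^ d := by
  let μ : Measure (Euc d) := Measure.addHaar
  let r : ℝ := δ / 2
  let ρ : ℝ := K + δ / 2
  have rpos : 0 < r := by positivity
  have ρpos : 0 < ρ := by positivity
  set A := ⋃ c ∈ s, ball (c : Euc d) r with hA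
  have D : Set.Pairwise (s : Set (Euc d)) (Disjoint on fun c => ball (c : Euc d) r) := by
    rintro c hc e he hce
    apply ball_disjoint_ball
    have := h c hc e he hce
    simp only [r]; linarith
  have A_subset : A ⊆ ball x0 ρ := by
    refine iUnion₂_subset fun x hx => ?_
    apply ball_subset_ball'
    have := hs x hx
    simp only [r, ρ]; linarith
  have I : (s.card : ENNReal) * ENNReal.ofReal (r ^ finrank ℝ (Euc d)) * μ (ball 0 1) ≤
      ENNReal.ofReal (ρ ^ finrank ℝ (Euc d)) * μ (ball 0 1) :=
    calc
      (s.card : ENNReal) * ENNReal.ofReal (r ^ finrank ℝ (Euc d)) * μ (ball 0 1) = μ A := by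
        rw [hA, measure_biUnion_finset D fun c _ => measurableSet_ball]
        simp only [μ.addHaar_ball_of_pos _ rpos]
        simp only [Finset.sum_const, nsmul_eq_mul, mul_assoc]
      _ ≤ μ (ball x0 ρ) := measure_mono A_subset
      _ = ENNReal.ofReal (ρ ^ finrank ℝ (Euc d)) * μ (ball 0 1) := by
        simp only [μ.addHaar_ball_of_pos _ ρpos]
  have J : (s.card : ENNReal) * ENNReal.ofReal (r ^ finrank ℝ (Euc d))
      ≤ ENNReal.ofReal (ρ ^ finrank ℝ (Euc d)) :=
    (ENNReal.mul_le_mul_iff_left (measure_ball_pos _ _ zero_lt_one).ne' measure_ball_lt_top.ne).1 I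
  have J2 := ENNReal.toReal_le_of_le_ofReal (pow_nonneg ρpos.le _) J
  have hfr : finrank ℝ (Euc d) = d := by simp
  rw [hfr, ENNReal.toReal_mul, ENNReal.toReal_ofReal (by positivity)] at J2
  simp only [ENNReal.toReal_natCast] at J2
  have e : (2 * K + δ) / δ = ρ / r := by simp only [ρ, r]; field_simp
  rw [e, div_pow, le_div_iff₀ (by positivity)]
  exact J2

lemma partition_set {d : ℕ} (A : Set (Euc d)) (K δ : ℝ) (hK : 0 ≤ K) (hδ : 0 < δ)
    (hA : ∀ x ∈ A, ∀ y ∈ A, dist x y ≤ K) (N : ℕ) (hN1 : 1 ≤ N)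
    (hN : ∀ n : ℕ, (n : ℝ) ≤ ((2 * K + δ) / δ) ^ d → n ≤ N) :
    ∃ F : Euc d → Fin N, ∀ x ∈ A, ∀ y ∈ A, F x = F y → dist x y ≤ 2 * δ := by
  classical
  rcases A.eq_empty_or_nonempty with rfl | ⟨x0, hx0⟩
  · exact ⟨fun _ => ⟨0, hN1⟩, by simp⟩
  let T : Set ℕ := {n | ∃ s : Finset (Euc d), (∀ c ∈ s, c ∈ A) ∧
    (∀ c ∈ s, ∀ e ∈ s, c ≠ e → δ ≤ dist c e) ∧ s.card = n}
  have hT : ∀ n ∈ T, n ≤ N := by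
    rintro n ⟨s, h1, h2, rfl⟩
    exact hN _ (packing_card s x0 K δ hK hδ (fun c hc => hA _ (h1 c hc) _ hx0) h2)
  have hTb : BddAbove T := ⟨N, hT⟩
  have hTn : T.Nonempty := ⟨0, ∅, by simp⟩
  obtain ⟨s, h1, h2, h3⟩ := Nat.sSup_mem hTn hTb
  have hcard : s.card ≤ N := by rw [h3]; exact hT _ (Nat.sSup_mem hTn hTb)
  have hcov : ∀ x ∈ A, ∃ c ∈ s, dist x c < δ := by
    intro x hx
    by_contra! hcon
    have hxs : x ∉ s := fun hxs => by
      have := hcon x hxs; simp at this; linarith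
    have : s.card + 1 ∈ T := by
      refine ⟨insert x s, ?_, ?_, Finset.card_insert_of_notMem hxs⟩
      · intro c hc
        rcases Finset.mem_insert.1 hc with rfl | hc
        · exact hx
        · exact h1 c hc
      · intro c hc e he hce
        rcases Finset.mem_insert.1 hc with hc' | hc' <;> rcases Finset.mem_insert.1 he with he' | he'
        · exact absurd (hc'.trans he'.symm) hce
        · rw [hc']; exact hcon e he'
        · rw [he', dist_comm]; exact hcon c hc'
        · exact h2 c hc' e he' hce
    have := le_csSup hTb this
    omega
  choose! G hG1 hG2 using hcov
  let φ : s ↪ Fin N := s.equivFin.toEmbedding.trans (Fin.castLEEmb hcard)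
  refine ⟨fun x => if h : G x ∈ s then φ ⟨G x, h⟩ else ⟨0, hN1⟩, ?_⟩
  intro x hx y hy hxy
  simp only [hG1 x hx, hG1 y hy, dif_pos] at hxy
  have := φ.injective hxy
  simp only [Subtype.mk.injEq] at this
  have a := hG2 x hx
  have b := hG2 y hy
  rw [← this] at b
  have := dist_triangle_right x y (G x)
  linarith

lemma coding {d : ℕ} {X : Type} (S : Set X) (pos : ℕ → X → Euc d) (T : ℕ) (lab : ℕ → X → Fin T)
    (K δ : ℝ) (hK : 0 ≤ K) (hδ : 0 < δ) (N : ℕ) (hN1 : 1 ≤ N) (hT : 1 ≤ T)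
    (hN : ∀ n : ℕ, (n : ℝ) ≤ ((2 * K + δ) / δ) ^ d → n ≤ N)
    (h0 : ∀ R ∈ S, ∀ R' ∈ S, dist (pos 0 R) (pos 0 R') ≤ K)
    (hs : ∀ j, ∀ R ∈ S, ∀ R' ∈ S, dist (pos j R) (pos j R') ≤ 2 * δ → lab j R = lab j R' →
      dist (pos (j + 1) R) (pos (j + 1) R') ≤ K) (j : ℕ) :
    ∃ code : X → Fin ((T * N) ^ (j + 1)), ∀ R ∈ S, ∀ R' ∈ S, code R = code R' →
      ∀ i ≤ j, dist (pos i R) (pos i R') ≤ 2 * δ := by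
  induction j with
  | zero =>
    obtain ⟨F, hF⟩ := partition_set (pos 0 '' S) K δ hK hδ (by
      rintro _ ⟨R, hR, rfl⟩ _ ⟨R', hR', rfl⟩
      exact h0 R hR R' hR') N hN1 hN
    refine ⟨fun R => Fin.castLE (by simpa using Nat.le_mul_of_pos_left N hT) (F (pos 0 R)), ?_⟩
    intro R hR R' hR' h i hi
    obtain rfl : i = 0 := by omega
    exact hF _ ⟨R, hR, rfl⟩ _ ⟨R', hR', rfl⟩ (Fin.castLE_injective _ h)
  | succ j ih =>
    obtain ⟨code, hcode⟩ := ih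
    have : ∀ (a : Fin ((T * N) ^ (j + 1))) (t : Fin T), ∃ F : Euc d → Fin N,
        ∀ x ∈ pos (j + 1) '' {R ∈ S | code R = a ∧ lab j R = t},
        ∀ y ∈ pos (j + 1) '' {R ∈ S | code R = a ∧ lab j R = t}, F x = F y → dist x y ≤ 2 * δ := by
      intro a t
      apply partition_set _ K δ hK hδ _ N hN1 hN
      rintro _ ⟨R, ⟨hR, h1, h2⟩, rfl⟩ _ ⟨R', ⟨hR', h1', h2'⟩, rfl⟩
      exact hs j R hR R' hR' (hcode R hR R' hR' (h1.trans h1'.symm) j le_rfl) (h2.trans h2'.symm)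
    choose F hF using this
    refine ⟨fun R => Fin.cast (by rw [pow_succ (T * N) (j + 1)]) (finProdFinEquiv (code R,
      finProdFinEquiv (lab j R, F (code R) (lab j R) (pos (j + 1) R)))), ?_⟩
    intro R hR R' hR' h i hi
    have h := finProdFinEquiv.injective (Fin.cast_injective _ h)
    rw [Prod.mk.injEq] at h
    obtain ⟨ha, h⟩ := h
    have h := finProdFinEquiv.injective h
    rw [Prod.mk.injEq] at h
    obtain ⟨hb, h⟩ := h
    rcases Nat.lt_or_ge i (j + 1) with hi' | hi'
    · exact hcode R hR R' hR' ha i (by omega)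
    · obtain rfl : i = j + 1 := by omega
      rw [← ha, ← hb] at h
      exact hF (code R) (lab j R) _ ⟨R, ⟨hR, rfl, rfl⟩, rfl⟩ _ ⟨R', ⟨hR', ha.symm, hb.symm⟩, rfl⟩ h

lemma curveMap_seg {d n : ℕ} (p : Fin (n + 1) → Euc d) (i : Fin n) (s : ℝ) (h0 : 0 ≤ s)
    (h1 : s ≤ 1) :
    curveMap p (((i : ℕ) + s) / n) = (1 - s) • p i.castSucc + s • p i.succ := by
  have hn : n ≠ 0 := by have := i.2; omega
  have hn' : (n : ℝ) ≠ 0 := by exact_mod_cast hn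
  have hin := i.2
  have key : ∀ x : ℝ, x = ((i : ℕ) : ℝ) + s → ∀ k : ℕ, (k = i ∨ (k = i + 1 ∧ s = 1)) →
      ∀ (hk : k < n + 1) (hk' : k + 1 < n + 1),
      (1 - (x - (k : ℕ))) • p ⟨k, hk⟩ + (x - (k : ℕ)) • p ⟨k + 1, hk'⟩ =
      (1 - s) • p i.castSucc + s • p i.succ := by
    rintro x rfl k (rfl | ⟨rfl, rfl⟩) hk hk'
    · simp only [add_sub_cancel_left]; rfl
    · have : ((i : ℕ) : ℝ) + 1 - ((i + 1 : ℕ) : ℝ) = 0 := by push_cast; ring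
      rw [this]
      simp only [sub_zero, one_smul, zero_smul, add_zero, sub_self, zero_add]
      rfl
  unfold curveMap
  rw [dif_neg hn]
  apply key
  · field_simp
  · have e : ((i : ℕ) + s) / n * (n : ℝ) = ((i : ℕ) : ℝ) + s := by field_simp
    rw [e]
    rcases lt_or_eq_of_le h1 with h | rfl
    · left
      have : ⌊((i : ℕ) : ℝ) + s⌋₊ = i := by
        rw [Nat.floor_eq_iff (by positivity)]
        constructor <;> linarith
      rw [this]; omega
    · have : ⌊((i : ℕ) : ℝ) + 1⌋₊ = i + 1 := by
        rw [Nat.floor_eq_iff (by positivity)]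
        constructor <;> push_cast <;> linarith
      rw [this]
      rcases Nat.lt_or_ge (i + 1) n with h | h
      · right; exact ⟨by omega, rfl⟩
      · left; omega

lemma curveMap_zero_edges {d : ℕ} (p : Fin (0 + 1) → Euc d) (t : ℝ) : curveMap p t = p 0 := by
  simp [curveMap]

lemma param_exists {n : ℕ} (hn : n ≠ 0) (t : ℝ) (h0 : 0 ≤ t) (h1 : t ≤ 1) :
    ∃ i : Fin n, ∃ s : ℝ, 0 ≤ s ∧ s ≤ 1 ∧ t = ((i : ℕ) + s) / n := by
  have hn' : (0 : ℝ) < n := by exact_mod_cast Nat.pos_of_ne_zero hn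
  have hf := Nat.floor_le (show 0 ≤ t * n by positivity)
  have hf2 := Nat.lt_floor_add_one (t * n)
  rcases Nat.lt_or_ge ⌊t * (n : ℝ)⌋₊ n with h | h
  · exact ⟨⟨_, h⟩, t * n - ⌊t * (n : ℝ)⌋₊, by linarith, by linarith, by field_simp; simp⟩
  · have : (n : ℝ) ≤ ⌊t * (n : ℝ)⌋₊ := by exact_mod_cast h
    have ht : t = 1 := by nlinarith
    refine ⟨⟨n - 1, by omega⟩, 1, by norm_num, le_rfl, ?_⟩
    rw [ht]
    have : ((n - 1 : ℕ) : ℝ) = n - 1 := by rw [Nat.cast_sub (by omega)]; simp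
    simp only [this]; field_simp; ring

lemma curveMap_start {d n : ℕ} (p : Fin (n + 1) → Euc d) : curveMap p 0 = p 0 := by
  rcases n with _ | n
  · exact curveMap_zero_edges p 0
  · have := curveMap_seg p (0 : Fin (n + 1)) 0 le_rfl zero_le_one
    simpa using this

lemma frechet_bdd {d : ℕ} (P Q : ℝ → Euc d) : BddBelow { r : ℝ | ∃ f g : ℝ → ℝ, IsRepar f ∧ IsRepar g ∧
    ∀ t ∈ Icc (0 : ℝ) 1, dist (P (f t)) (Q (g t)) ≤ r } := by
  refine ⟨0, ?_⟩
  rintro r ⟨f, g, _, _, h⟩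
  exact dist_nonneg.trans (h 0 (by simp))

lemma isRepar_id : IsRepar (fun t => t) :=
  ⟨continuousOn_id, monotone_id.monotoneOn _, by simp⟩

lemma frechet_le_of_vertices {d m : ℕ} (p q : Fin (m + 1) → Euc d) (r : ℝ)
    (h : ∀ i, dist (p i) (q i) ≤ r) : frechetDist (curveMap p) (curveMap q) ≤ r := by
  refine csInf_le (frechet_bdd _ _) ⟨fun t => t, fun t => t, isRepar_id, isRepar_id, ?_⟩
  intro t ht
  rcases m with _ | m
  · rw [curveMap_zero_edges, curveMap_zero_edges]; exact h 0
  · obtain ⟨i, s, h0, h1, rfl⟩ := param_exists (Nat.succ_ne_zero m) t ht.1 ht.2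
    simp only []
    rw [curveMap_seg _ i s h0 h1, curveMap_seg _ i s h0 h1]
    have a := h i.castSucc
    have b := h i.succ
    rw [dist_eq_norm] at a b ⊢
    have : (1 - s) • p i.castSucc + s • p i.succ - ((1 - s) • q i.castSucc + s • q i.succ)
      = (1 - s) • (p i.castSucc - q i.castSucc) + s • (p i.succ - q i.succ) := by module
    rw [this]
    refine (norm_add_le _ _).trans ?_
    rw [norm_smul, norm_smul, Real.norm_of_nonneg h0, Real.norm_of_nonneg (by linarith : 0 ≤ 1 - s)]
    nlinarith

lemma curveMap_bound {d n : ℕ} (p : Fin (n + 1) → Euc d) :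
    ∃ B, ∀ t ∈ Icc (0 : ℝ) 1, ‖curveMap p t‖ ≤ B := by
  have hB : ∀ i, ‖p i‖ ≤ ∑ i, ‖p i‖ :=
    fun i => Finset.single_le_sum (f := fun i => ‖p i‖) (fun _ _ => norm_nonneg _) (Finset.mem_univ i)
  refine ⟨∑ i, ‖p i‖, fun t ht => ?_⟩
  rcases n with _ | n
  · rw [curveMap_zero_edges]; exact hB 0
  · obtain ⟨i, s, h0, h1, rfl⟩ := param_exists (Nat.succ_ne_zero n) t ht.1 ht.2
    rw [curveMap_seg _ i s h0 h1]
    refine (norm_add_le _ _).trans ?_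
    rw [norm_smul, norm_smul, Real.norm_of_nonneg h0, Real.norm_of_nonneg (by linarith : 0 ≤ 1 - s)]
    have a := hB i.castSucc
    have b := hB i.succ
    nlinarith

lemma frechet_witness {d n m : ℕ} (p : Fin (n + 1) → Euc d) (q : Fin (m + 1) → Euc d) (Δ D : ℝ)
    (hD : Δ < D) (h : frechetDist (curveMap p) (curveMap q) ≤ Δ) :
    ∃ f g : ℝ → ℝ, IsRepar f ∧ IsRepar g ∧
    ∀ t ∈ Icc (0 : ℝ) 1, dist (curveMap p (f t)) (curveMap q (g t)) ≤ D := by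
  obtain ⟨B, hB⟩ := curveMap_bound p
  obtain ⟨B', hB'⟩ := curveMap_bound q
  have hne : { r : ℝ | ∃ f g : ℝ → ℝ, IsRepar f ∧ IsRepar g ∧
      ∀ t ∈ Icc (0 : ℝ) 1, dist (curveMap p (f t)) (curveMap q (g t)) ≤ r }.Nonempty := by
    refine ⟨B + B', fun t => t, fun t => t, isRepar_id, isRepar_id, fun t ht => ?_⟩
    rw [dist_eq_norm]
    exact (norm_sub_le _ _).trans (add_le_add (hB t ht) (hB' t ht))
  obtain ⟨r, ⟨f, g, hf, hg, hr⟩, hlt⟩ := exists_lt_of_csInf_lt hne (lt_of_le_of_lt h hD)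
  exact ⟨f, g, hf, hg, fun t ht => (hr t ht).trans hlt.le⟩

lemma repar_mem {f : ℝ → ℝ} (hf : IsRepar f) {t : ℝ} (ht : t ∈ Icc (0 : ℝ) 1) :
    f t ∈ Icc (0 : ℝ) 1 := by
  rw [← hf.2.2]; exact ⟨t, ht, rfl⟩

lemma repar_surj {f : ℝ → ℝ} (hf : IsRepar f) {x : ℝ} (hx : x ∈ Icc (0 : ℝ) 1) :
    ∃ t ∈ Icc (0 : ℝ) 1, f t = x := by
  rw [← hf.2.2] at hx; exact hx

lemma repar_zero {f : ℝ → ℝ} (hf : IsRepar f) : f 0 = 0 := by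
  obtain ⟨t, ht, h⟩ := repar_surj hf (x := 0) (by simp)
  have := hf.2.1 (by simp) ht ht.1
  have h2 := repar_mem hf (t := 0) (by simp)
  linarith [h2.1]

lemma geo_far {d : ℕ} (q q' a' y z u : Euc d) (s D τ : ℝ) (hu : ‖u‖ = 1) (hD : 0 < D)
    (hy : y - a' = s • u) (hs : 10 * D < s) (h1 : dist a' z ≤ D) (h2 : dist y q' ≤ D)
    (hz : z = (1 - τ) • q + τ • q') (hτ : τ ≤ 1) :
    2 / 3 * ‖q' - q‖ ≤ inner ℝ (q' - q) u := by
  have e1 : ‖(1 - τ) • (q' - q) - s • u‖ ≤ 2 * D := by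
    have : (1 - τ) • (q' - q) - s • u = (q' - y) + (a' - z) := by rw [← hy, hz]; module
    rw [this]
    refine (norm_add_le _ _).trans ?_
    rw [← dist_eq_norm, ← dist_eq_norm, dist_comm q' y]; linarith
  have e2 : |inner ℝ ((1 - τ) • (q' - q) - s • u) u| ≤ 2 * D := by
    have := abs_real_inner_le_norm ((1 - τ) • (q' - q) - s • u) u
    rw [hu, mul_one] at this; linarith
  rw [inner_sub_left, real_inner_smul_left, real_inner_smul_left, real_inner_self_eq_norm_sq, hu] at e2
  have e3 : (1 - τ) * ‖q' - q‖ ≤ s + 2 * D := by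
    have : ‖(1 - τ) • (q' - q)‖ ≤ ‖(1 - τ) • (q' - q) - s • u‖ + ‖s • u‖ := by
      simpa using norm_add_le ((1 - τ) • (q' - q) - s • u) (s • u)
    rw [norm_smul, norm_smul s, hu, Real.norm_of_nonneg (by linarith : 0 ≤ 1 - τ),
      Real.norm_of_nonneg (by linarith : 0 ≤ s)] at this
    linarith
  have e4 := (abs_le.1 e2).1
  have e5 : 0 < 1 - τ := by
    rcases lt_or_eq_of_le hτ with h | h
    · linarith
    · rw [h] at e4; linarith
  by_contra! hc
  nlinarith

lemma geo_two {d : ℕ} (q q' r r' a u : Euc d) (α β D ℓ : ℝ) (hu : ‖u‖ = 1) (hD : 0 < D)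
    (hδ : dist q r ≤ D)
    (hq : dist q' (a + α • u) ≤ D) (hr : dist r' (a + β • u) ≤ D)
    (lq : dist q q' = ℓ) (lr : dist r r' = ℓ)
    (iq : 2 / 3 * ‖q' - q‖ ≤ inner ℝ (q' - q) u) (ir : 2 / 3 * ‖r' - r‖ ≤ inner ℝ (r' - r) u) :
    dist q' r' ≤ 7 * D := by
  have hℓ : 0 ≤ ℓ := lq ▸ dist_nonneg
  have hqn : ‖q' - q‖ = ℓ := by rw [← dist_eq_norm, dist_comm, lq]
  have hrn : ‖r' - r‖ = ℓ := by rw [← dist_eq_norm, dist_comm, lr]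
  rcases hℓ.eq_or_lt with h0 | hpos
  · have a1 : q = q' := dist_eq_zero.1 (lq.trans h0.symm)
    have a2 : r = r' := dist_eq_zero.1 (lr.trans h0.symm)
    rw [← a1, ← a2]; linarith
  rw [dist_eq_norm] at hδ hq hr
  set e := (q' - q) - (r' - r) - (α - β) • u with he
  have hen : ‖e‖ ≤ 3 * D := by
    have : e = (q' - (a + α • u)) - (r' - (a + β • u)) - (q - r) := by rw [he]; module
    rw [this]
    have := norm_sub_le ((q' - (a + α • u)) - (r' - (a + β • u))) (q - r)
    have := norm_sub_le (q' - (a + α • u)) (r' - (a + β • u))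
    linarith
  have hz : inner ℝ ((q' - q) - (r' - r)) ((q' - q) + (r' - r)) = (0 : ℝ) := by
    rw [inner_sub_left, inner_add_right, inner_add_right, real_inner_self_eq_norm_sq,
      real_inner_self_eq_norm_sq, real_inner_comm, hqn, hrn]; ring
  have hdec : (q' - q) - (r' - r) = (α - β) • u + e := by rw [he]; module
  rw [hdec, inner_add_left, real_inner_smul_left] at hz
  have h2 : |inner ℝ e ((q' - q) + (r' - r))| ≤ 3 * D * (2 * ℓ) := by
    refine (abs_real_inner_le_norm _ _).trans ?_
    have := norm_add_le (q' - q) (r' - r)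
    rw [hqn, hrn] at this
    apply mul_le_mul hen (by linarith) (norm_nonneg _) (by positivity)
  have h3 : 4 / 3 * ℓ ≤ inner ℝ u ((q' - q) + (r' - r)) := by
    rw [inner_add_right, real_inner_comm, real_inner_comm (r' - r)]
    rw [hqn] at iq; rw [hrn] at ir; linarith
  have h4 : |α - β| * (4 / 3 * ℓ) ≤ 3 * D * (2 * ℓ) := by
    calc |α - β| * (4 / 3 * ℓ) ≤ |α - β| * inner ℝ u ((q' - q) + (r' - r)) := by gcongr
      _ = |(α - β) * inner ℝ u ((q' - q) + (r' - r))| := by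
        rw [abs_mul, abs_of_nonneg (a := inner ℝ u _) (by nlinarith)]
      _ = |inner ℝ e ((q' - q) + (r' - r))| := by
        rw [← abs_neg (inner ℝ e _)]; congr 1; linarith
      _ ≤ _ := h2
  have h5 : |α - β| ≤ 5 * D := by
    by_contra! hc
    nlinarith
  rw [dist_eq_norm]
  have : q' - r' = (q' - (a + α • u)) - (r' - (a + β • u)) + (α - β) • u := by module
  rw [this]
  have b1 := norm_add_le ((q' - (a + α • u)) - (r' - (a + β • u))) ((α - β) • u)
  have b2 := norm_sub_le (q' - (a + α • u)) (r' - (a + β • u))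
  rw [norm_smul, hu, Real.norm_eq_abs] at b1
  linarith

/-- Coarse label of the step from a vertex to the next vertex. -/
def LabProp {d n : ℕ} (P : Fin (n + 1) → Euc d) (D ε : ℝ) (μ : ℕ) (q q' : Euc d)
    (i : Fin (n + 1)) (v : ℕ) : Prop :=
  (v = μ + 1 ∧ dist q' (P i) ≤ 11 * D) ∨ (v = μ + 2 ∧ dist q' q ≤ 12 * D) ∨
  (v ≤ μ ∧ dist q q' = v * ε ∧ ∃ e : Fin n, e.castSucc = i ∧
    ‖(‖P e.succ - P e.castSucc‖⁻¹ • (P e.succ - P e.castSucc))‖ = 1 ∧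
    (∃ α : ℝ, dist q' (P e.castSucc + α • (‖P e.succ - P e.castSucc‖⁻¹ •
      (P e.succ - P e.castSucc))) ≤ D) ∧
    2 / 3 * ‖q' - q‖ ≤ inner ℝ (q' - q) (‖P e.succ - P e.castSucc‖⁻¹ •
      (P e.succ - P e.castSucc)))

lemma labProp_two {d n : ℕ} (P : Fin (n + 1) → Euc d) (D ε : ℝ) (hD : 0 < D) (μ : ℕ)
    (q q' r r' : Euc d) (i : Fin (n + 1)) (v : ℕ) (h1 : LabProp P D ε μ q q' i v)
    (h2 : LabProp P D ε μ r r' i v) (h : dist q r ≤ D) : dist q' r' ≤ 25 * D := by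
  rcases h1 with ⟨hv, h1⟩ | ⟨hv, h1⟩ | ⟨hv, h1, e, he, hu, ⟨α, hα⟩, hi⟩ <;>
  rcases h2 with ⟨hv', h2⟩ | ⟨hv', h2⟩ | ⟨hv', h2, e', he', hu', ⟨β, hβ⟩, hi'⟩ <;> try omega
  · have := dist_triangle_right q' r' (P i); linarith
  · have := dist_triangle4 q' q r r'
    rw [dist_comm r r'] at this; linarith
  · obtain rfl : e = e' := Fin.castSucc_injective _ (he.trans he'.symm)
    have := geo_two q q' r r' _ _ α β D _ hu hD h hα hβ h1 h2 hi hi'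
    linarith

lemma label_of_param {d n : ℕ} (P : Fin (n + 1) → Euc d) (D ε : ℝ) (hD : 0 < D) (μ v : ℕ)
    (q q' a' z : Euc d) (hv : v ≤ μ) (hd : dist q q' = v * ε) (e : Fin n) (σ lam τ : ℝ)
    (hσ : σ ≤ lam)
    (ha : a' = (1 - σ) • P e.castSucc + σ • P e.succ)
    (hy : dist ((1 - lam) • P e.castSucc + lam • P e.succ) q' ≤ D)
    (hz : z = (1 - τ) • q + τ • q') (hτ : τ ≤ 1) (haz : dist a' z ≤ D)
    (halt : σ = 0 ∨ z = q) :
    ∃ i v', v' < μ + 3 ∧ LabProp P D ε μ q q' i v' := by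
  set y := (1 - lam) • P e.castSucc + lam • P e.succ with hydef
  rcases le_or_gt (dist y a') (10 * D) with hnear | hfar
  · rcases halt with h | h
    · refine ⟨e.castSucc, μ + 1, by omega, Or.inl ⟨rfl, ?_⟩⟩
      rw [h] at ha
      simp only [sub_zero, one_smul, zero_smul, add_zero] at ha
      rw [← ha]
      have := dist_triangle q' y a'
      rw [dist_comm q' y] at this; linarith
    · refine ⟨e.castSucc, μ + 2, by omega, Or.inr (Or.inl ⟨rfl, ?_⟩)⟩
      rw [h] at haz
      have := dist_triangle4 q' y a' q
      rw [dist_comm q' y] at this; linarith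
  · refine ⟨e.castSucc, v, by omega, Or.inr (Or.inr ⟨hv, hd, e, rfl, ?_⟩)⟩
    set w := P e.succ - P e.castSucc with hw
    have hya : y - a' = (lam - σ) • w := by rw [hydef, ha, hw]; module
    have hdist : dist y a' = (lam - σ) * ‖w‖ := by
      rw [dist_eq_norm, hya, norm_smul, Real.norm_of_nonneg (by linarith)]
    have hw0 : ‖w‖ ≠ 0 := by
      intro h0
      rw [hdist, h0] at hfar; linarith
    have hu : ‖‖w‖⁻¹ • w‖ = 1 := by
      rw [norm_smul, norm_inv, norm_norm]; field_simp
    refine ⟨hu, ⟨lam * ‖w‖, ?_⟩, ?_⟩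
    · have : P e.castSucc + (lam * ‖w‖) • ‖w‖⁻¹ • w = y := by
        rw [smul_smul, mul_assoc, mul_inv_cancel₀ hw0, mul_one, hydef, hw]; module
      rw [this, dist_comm]; exact hy
    · refine geo_far q q' a' y z _ ((lam - σ) * ‖w‖) D τ hu hD ?_ (hdist ▸ hfar) haz hy hz hτ
      rw [hya, smul_smul, mul_assoc, mul_inv_cancel₀ hw0, mul_one]

lemma exists_label {d n m : ℕ} (P : Fin (n + 1) → Euc d) (R : Fin (m + 1) → Euc d) (D ε : ℝ)
    (hε : 0 < ε) (hD : 0 < D) (μ : ℕ) (hR : IsMuEpsEdges R μ ε) (f g : ℝ → ℝ) (hf : IsRepar f)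
    (hg : IsRepar g)
    (hfg : ∀ t ∈ Icc (0 : ℝ) 1, dist (curveMap P (f t)) (curveMap R (g t)) ≤ D) (j : Fin m) :
    ∃ i v, v < μ + 3 ∧ LabProp P D ε μ (R j.castSucc) (R j.succ) i v := by
  have hm : (0 : ℝ) < m := by
    have := j.2
    exact_mod_cast (by omega : 0 < m)
  have hjm : ((j : ℕ) : ℝ) + 1 ≤ m := by exact_mod_cast j.2
  have hj0 : (0 : ℝ) ≤ ((j : ℕ) : ℝ) := by positivity
  obtain ⟨⟨v, hv⟩, hle⟩ := hR j
  have hvμ : v ≤ μ := by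
    rw [hv] at hle
    exact_mod_cast le_of_mul_le_mul_right hle hε
  have hRj := curveMap_seg R j
  obtain ⟨t1, ht1, hgt1⟩ := repar_surj hg (x := (((j : ℕ) : ℝ) + 0) / m)
    ⟨by positivity, by rw [div_le_one hm]; linarith⟩
  obtain ⟨t2, ht2, hgt2⟩ := repar_surj hg (x := (((j : ℕ) : ℝ) + 1) / m)
    ⟨by positivity, by rw [div_le_one hm]; linarith⟩
  have ht12 : t1 ≤ t2 := by
    by_contra! hc
    have := hg.2.1 ht2 ht1 hc.le
    rw [hgt1, hgt2, div_le_div_iff_of_pos_right hm] at this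
    linarith
  have hq1 := hfg t1 ht1
  have hq2 := hfg t2 ht2
  rw [hgt1, hRj 0 le_rfl zero_le_one] at hq1
  rw [hgt2, hRj 1 zero_le_one le_rfl] at hq2
  simp only [sub_zero, one_smul, zero_smul, add_zero, sub_self, zero_add] at hq1 hq2
  rcases Nat.eq_zero_or_pos n with hn0 | hn
  · subst hn0
    rw [curveMap_zero_edges] at hq2
    refine ⟨0, μ + 1, by omega, Or.inl ⟨rfl, ?_⟩⟩
    rw [dist_comm]; linarith
  have hnR : (0 : ℝ) < n := by exact_mod_cast hn
  have hx := repar_mem hf ht1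
  have hy := repar_mem hf ht2
  have hxy := hf.2.1 ht1 ht2 ht12
  obtain ⟨e, lam, hl0, hl1, hl⟩ := param_exists hn.ne' (f t2) hy.1 hy.2
  rw [hl, curveMap_seg P e lam hl0 hl1] at hq2
  rcases le_or_gt (f t1) ((((e : ℕ) : ℝ) + 0) / n) with hc | hc
  · -- the start of the edge `e` is passed in between
    have hlow : (((e : ℕ) : ℝ) + 0) / n ≤ f t2 := by
      rw [hl]; gcongr
    have hsub : Icc t1 t2 ⊆ Icc (0 : ℝ) 1 := Icc_subset_Icc ht1.1 ht2.2
    obtain ⟨s, hs, hfs⟩ := intermediate_value_Icc ht12 (hf.1.mono hsub) ⟨hc, hlow⟩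
    have hs' := hsub hs
    have hg1 := hg.2.1 ht1 hs' hs.1
    have hg2 := hg.2.1 hs' ht2 hs.2
    rw [hgt1, div_le_iff₀ hm] at hg1
    rw [hgt2, le_div_iff₀ hm] at hg2
    have hgs : g s = (((j : ℕ) : ℝ) + (g s * m - j)) / m := by field_simp; ring
    have hq := hfg s hs'
    rw [hfs, curveMap_seg P e 0 le_rfl zero_le_one, hgs,
      hRj (g s * m - j) (by linarith) (by linarith)] at hq
    exact label_of_param P D ε hD μ v _ _ _ _ hvμ hv e 0 lam (g s * m - j) hl0 rfl hq2 rfl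
      (by linarith) hq (Or.inl rfl)
  · have hft1 : f t1 = (((e : ℕ) : ℝ) + (f t1 * n - e)) / n := by field_simp; ring
    rw [hl, le_div_iff₀ hnR] at hxy
    rw [div_lt_iff₀ hnR] at hc
    rw [hft1, curveMap_seg P e (f t1 * n - e) (by linarith) (by linarith)] at hq1
    exact label_of_param P D ε hD μ v _ _ _ (R j.castSucc) hvμ hv e (f t1 * n - e) lam 0
      (by linarith) rfl hq2 (by simp) zero_le_one hq1 (Or.inr rfl)

lemma exists_code {d n : ℕ} (P : Fin (n + 1) → Euc d) (m μ : ℕ) (ε Δ c : ℝ) (hε : 0 < ε)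
    (hΔ : 0 < Δ) (hc : 1 ≤ c) :
    ∃ code : (Fin (m + 1) → Euc d) →
      Fin ((((n + 1) * (μ + 3)) * ⌊(201 * c) ^ d⌋₊) ^ (m + 1)),
      ∀ R, IsMuEpsEdges R μ ε → frechetDist (curveMap P) (curveMap R) ≤ Δ →
      ∀ R', IsMuEpsEdges R' μ ε → frechetDist (curveMap P) (curveMap R') ≤ Δ →
      code R = code R' → ∀ i, dist (R i) (R' i) ≤ Δ / c := by
  classical
  have hcpos : 0 < c := by linarith
  let S : Set (Fin (m + 1) → Euc d) :=
    {R | IsMuEpsEdges R μ ε ∧ frechetDist (curveMap P) (curveMap R) ≤ Δ}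
  let pos : ℕ → (Fin (m + 1) → Euc d) → Euc d := fun j R => R ⟨min j m, by omega⟩
  have hex : ∀ (j : ℕ) (R : Fin (m + 1) → Euc d), ∃ l : Fin ((n + 1) * (μ + 3)),
      R ∈ S → j < m → LabProp P (2 * Δ) ε μ (pos j R) (pos (j + 1) R)
        (finProdFinEquiv.symm l).1 (finProdFinEquiv.symm l).2 := by
    intro j R
    by_cases h : R ∈ S ∧ j < m
    · obtain ⟨⟨hR, hF⟩, hj⟩ := h
      obtain ⟨f, g, hf, hg, hfg⟩ := frechet_witness P R Δ (2 * Δ) (by linarith) hF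
      obtain ⟨i, v, hv, hl⟩ := exists_label P R (2 * Δ) ε hε (by linarith) μ hR f g hf hg hfg ⟨j, hj⟩
      refine ⟨finProdFinEquiv (i, ⟨v, hv⟩), fun _ _ => ?_⟩
      rw [Equiv.symm_apply_apply]
      have e1 : pos j R = R (Fin.castSucc ⟨j, hj⟩) := by
        simp only [pos]; congr 1; ext; simp; omega
      have e2 : pos (j + 1) R = R (Fin.succ ⟨j, hj⟩) := by
        simp only [pos]; congr 1; ext; simp; omega
      rw [e1, e2]; exact hl
    · exact ⟨finProdFinEquiv (0, 0), fun h1 h2 => absurd ⟨h1, h2⟩ h⟩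
  choose lab hlab using hex
  have h2δ : 2 * (Δ / (2 * c)) = Δ / c := by field_simp
  have hΔc : Δ / c ≤ Δ := div_le_self hΔ.le hc
  have hbase : (1 : ℝ) ≤ (201 * c) ^ d := one_le_pow₀ (by linarith)
  obtain ⟨code, hcode⟩ := coding S pos ((n + 1) * (μ + 3)) lab (50 * Δ) (Δ / (2 * c))
    (by positivity) (by positivity) ⌊(201 * c) ^ d⌋₊
    (by rw [Nat.one_le_floor_iff]; exact hbase) (Nat.succ_le_of_lt (by positivity))
    (by
      intro N hN
      apply Nat.le_floor
      refine hN.trans ?_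
      have : (2 * (50 * Δ) + Δ / (2 * c)) / (Δ / (2 * c)) = 200 * c + 1 := by field_simp; ring
      rw [this]
      gcongr; linarith)
    (by
      have key : ∀ R ∈ S, dist (pos 0 R) (P 0) ≤ 2 * Δ := by
        rintro R ⟨hR, hF⟩
        obtain ⟨f, g, hf, hg, hfg⟩ := frechet_witness P R Δ (2 * Δ) (by linarith) hF
        have := hfg 0 (by simp)
        rw [repar_zero hf, repar_zero hg, curveMap_start, curveMap_start, dist_comm] at this
        have e : pos 0 R = R 0 := by
          simp only [pos]; congr 1
        rw [e]; exact this
      intro R hR R' hR'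
      have := dist_triangle_right (pos 0 R) (pos 0 R') (P 0)
      linarith [key R hR, key R' hR'])
    (by
      intro j R hR R' hR' hd hl
      rw [h2δ] at hd
      rcases Nat.lt_or_ge j m with hj | hj
      · have a := hlab j R hR hj
        have b := hlab j R' hR' hj
        rw [← hl] at b
        have := labProp_two P (2 * Δ) ε (by linarith) μ _ _ _ _ _ _ a b (by linarith)
        linarith
      · have e : ∀ R, pos (j + 1) R = pos j R := by
          intro R
          simp only [pos]; congr 1; ext; simp; omega
        rw [e, e]; linarith)
    m
  refine ⟨code, ?_⟩
  intro R hR hF R' hR' hF' h i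
  have := hcode R ⟨hR, hF⟩ R' ⟨hR', hF'⟩ h i (by omega)
  rw [h2δ] at this
  have e : ∀ R, pos i R = R i := by
    intro R
    simp only [pos]; congr 1; ext; simp; omega
  rwa [e, e] at this

/-- Lemma 3.12 of the paper. For every `(μ,ε)`-curve `P` of complexity at
most `k`, every `Δ > 0` and `c ≥ 1`, there is a family of at most `(k·μ·(C₀·c)^d)^k`
polygonal curves of complexity at most `k` with edge lengths at most `μ·ε + Δ/c` such that
every `(μ,ε)`-curve `Q` of complexity at most `k` with `d_F(P,Q) ≤ Δ` is within Fréchet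
distance `Δ/c` of a member of the family. -/
theorem cover_family :
    ∃ C₀ : ℝ, 1 ≤ C₀ ∧
      ∀ (d k μ : ℕ), 1 ≤ d → 1 ≤ k → 1 ≤ μ →
      ∀ (ε Δ c : ℝ), 0 < ε → 0 < Δ → 1 ≤ c →
      ∀ (n : ℕ) (P : Fin (n + 1) → Euc d), n + 1 ≤ k → IsMuEpsEdges P μ ε →
      ∃ (M : ℕ) (Q : Fin M → Σ m : ℕ, Fin (m + 1) → Euc d),
        (M : ℝ) ≤ ((k : ℝ) * μ * (C₀ * c) ^ d) ^ k ∧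
        (∀ i, (Q i).1 + 1 ≤ k ∧ EdgeLenLe (Q i).2 (μ * ε + Δ / c)) ∧
        ∀ (m : ℕ) (R : Fin (m + 1) → Euc d), m + 1 ≤ k → IsMuEpsEdges R μ ε →
          frechetDist (curveMap P) (curveMap R) ≤ Δ →
          ∃ i, frechetDist (curveMap R) (curveMap (Q i).2) ≤ Δ / c := by
  classical
  refine ⟨1608, by norm_num, ?_⟩
  intro d k μ hd hk hμ ε Δ c hε hΔ hc n P hn hP
  have hbase : (1 : ℝ) ≤ (201 * c) ^ d := one_le_pow₀ (by linarith)
  set N : ℕ := ((n + 1) * (μ + 3)) * ⌊(201 * c) ^ d⌋₊ with hN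
  have hfl : 1 ≤ ⌊(201 * c) ^ d⌋₊ := by rw [Nat.one_le_floor_iff]; exact hbase
  have hN1 : 1 ≤ N := Nat.succ_le_of_lt (Nat.mul_pos (by positivity) hfl)
  have hcode := fun m => exists_code P m μ ε Δ c hε hΔ hc
  choose code hcode using hcode
  -- representatives
  have hrep : ∀ (m : Fin k) (x : Fin (N ^ k)), ∃ Z : Σ m : ℕ, Fin (m + 1) → Euc d,
      (Z.1 + 1 ≤ k ∧ IsMuEpsEdges Z.2 μ ε) ∧
      ∀ R : Fin ((m : ℕ) + 1) → Euc d, IsMuEpsEdges R μ ε →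
        frechetDist (curveMap P) (curveMap R) ≤ Δ → ((code m R : ℕ) = x) →
        frechetDist (curveMap R) (curveMap Z.2) ≤ Δ / c := by
    intro m x
    by_cases h : ∃ R : Fin ((m : ℕ) + 1) → Euc d, IsMuEpsEdges R μ ε ∧
        frechetDist (curveMap P) (curveMap R) ≤ Δ ∧ ((code m R : ℕ) = x)
    · obtain ⟨R0, h1, h2, h3⟩ := h
      refine ⟨⟨m, R0⟩, ⟨m.2, h1⟩, fun R hR hF hx => ?_⟩
      exact frechet_le_of_vertices R R0 _
        (hcode m R hR hF R0 h1 h2 (Fin.ext (hx.trans h3.symm)))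
    · exact ⟨⟨n, P⟩, ⟨hn, hP⟩, fun R hR hF hx => absurd ⟨R, hR, hF, hx⟩ h⟩
  choose Z hZ1 hZ2 using hrep
  refine ⟨k * N ^ k, fun i => Z (finProdFinEquiv.symm i).1 (finProdFinEquiv.symm i).2, ?_, ?_, ?_⟩
  · have h1 : (k : ℝ) ≤ 2 ^ k := by exact_mod_cast Nat.lt_two_pow_self.le
    have hkR : ((n : ℝ) + 1) ≤ k := by exact_mod_cast hn
    have hμR : (1 : ℝ) ≤ μ := by exact_mod_cast hμ
    have h2 : (N : ℝ) ≤ k * (4 * μ) * (201 * c) ^ d := by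
      rw [hN]; push_cast
      have := Nat.floor_le (show 0 ≤ (201 * c) ^ d by linarith)
      gcongr
      linarith
    have h8 : (8 : ℝ) ≤ 8 ^ d := le_self_pow₀ (by norm_num) (by omega)
    have h3 : 2 * (N : ℝ) ≤ k * μ * (1608 * c) ^ d := by
      have e : (1608 * c) ^ d = 8 ^ d * (201 * c) ^ d := by rw [← mul_pow]; ring_nf
      rw [e]
      calc 2 * (N : ℝ) ≤ 2 * (k * (4 * μ) * (201 * c) ^ d) := by linarith
        _ = k * μ * (8 * (201 * c) ^ d) := by ring
        _ ≤ _ := by gcongr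
    push_cast
    calc (k : ℝ) * (N : ℝ) ^ k ≤ 2 ^ k * (N : ℝ) ^ k := by gcongr
      _ = (2 * (N : ℝ)) ^ k := by rw [mul_pow]
      _ ≤ _ := by gcongr
  · intro i
    refine ⟨(hZ1 _ _).1, fun e => ((hZ1 _ _).2 e).2.trans ?_⟩
    have : 0 ≤ Δ / c := by positivity
    linarith
  · intro m R hm hR hF
    have hlt : (code m R : ℕ) < N ^ k :=
      lt_of_lt_of_le (code m R).2 (Nat.pow_le_pow_right hN1 hm)
    refine ⟨finProdFinEquiv (⟨m, hm⟩, ⟨code m R, hlt⟩), ?_⟩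
    have key : ∀ y : Fin k × Fin (N ^ k), y = (⟨m, hm⟩, ⟨code m R, hlt⟩) →
        frechetDist (curveMap R) (curveMap (Z y.1 y.2).2) ≤ Δ / c := by
      rintro y rfl
      exact hZ2 ⟨m, hm⟩ ⟨code m R, hlt⟩ R hR hF rfl
    exact key _ (Equiv.symm_apply_apply _ _)
end
end

section
/- There exists an absolute constant C > 0 such that the following holds for all d,k ≥ 1. Let S be a finite set of at least two polygonal curves of complexity at most k in ℝ^d whose pairwise Fréchet distances are all nonzero, and suppose at least one pair of objects of S (vertices or edges, viewed as subsets of ℝ^d) is at nonzero distance. Then (max_{e ∈ E(S)} ‖e‖) / (min_{s ≠ s' ∈ S} d_F(s,s')) ≤ C · Φ(S), where E(S) is the set of edges of curves in S, ‖e‖ denotes the length of edge e, and Φ(S) is the spread of the collection of vertices and edges of the curves in S, i.e., the ratio of the maximal pairwise set-distance among those objects to the minimal nonzero pairwise set-distance, with the distance between two sets A,B ⊆ ℝ^d defined as min_{a ∈ A, b ∈ B} ‖a − b‖. (In the paper's notation: 𝒢(S)⁻¹ = O(Φ(S)), where 𝒢(S) = min_{s≠s'} d_F(s,s') / max_{e∈E(S)}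 ‖e‖ is the bundledness of S.) -/
open Set Metric Function

noncomputable section

/-- The distance between two subsets of `ℝ^d`: the infimum (for our compact objects, the
minimum) of `‖a − b‖` over `a ∈ A`, `b ∈ B`. -/
def setDist {d : ℕ} (A B : Set (Euc d)) : ℝ :=
  sInf { r : ℝ | ∃ a ∈ A, ∃ b ∈ B, dist a b = r }

/-- The objects of a set `S` of polygonal curves: the vertices (as singletons) and the edges
(as segments), viewed as subsets of `ℝ^d`. -/
def objects {d : ℕ} (S : Finset (Σ n : ℕ, Fin (n + 1) → Euc d)) : Set (Set (Euc d)) :=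
  { A | ∃ s ∈ S, (∃ i : Fin (s.1 + 1), A = {s.2 i}) ∨
      ∃ i : Fin s.1, A = segment ℝ (s.2 i.castSucc) (s.2 i.succ) }

/-- The maximal pairwise distance among the objects of `S`. -/
def maxObjDist {d : ℕ} (S : Finset (Σ n : ℕ, Fin (n + 1) → Euc d)) : ℝ :=
  sSup { r : ℝ | ∃ A ∈ objects S, ∃ B ∈ objects S, setDist A B = r }

/-- The minimal nonzero pairwise distance among the objects of `S`. -/
def minPosObjDist {d : ℕ} (S : Finset (Σ n : ℕ, Fin (n + 1) → Euc d)) : ℝ :=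
  sInf { r : ℝ | (∃ A ∈ objects S, ∃ B ∈ objects S, setDist A B = r) ∧ 0 < r }

/-- The spread `Φ(S)` of the collection of vertices and edges of the curves in `S`. -/
def spread {d : ℕ} (S : Finset (Σ n : ℕ, Fin (n + 1) → Euc d)) : ℝ :=
  maxObjDist S / minPosObjDist S

/-- The maximal edge length among the curves in `S`. -/
def maxEdgeLen {d : ℕ} (S : Finset (Σ n : ℕ, Fin (n + 1) → Euc d)) : ℝ :=
  sSup { r : ℝ | ∃ s ∈ S, ∃ i : Fin s.1, dist (s.2 i.castSucc) (s.2 i.succ) = r }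

/-- The minimal pairwise Fréchet distance among distinct curves of `S`. -/
def minFrechet {d : ℕ} (S : Finset (Σ n : ℕ, Fin (n + 1) → Euc d)) : ℝ :=
  sInf { r : ℝ | ∃ s ∈ S, ∃ s' ∈ S, s ≠ s' ∧
    frechetDist (curveMap s.2) (curveMap s'.2) = r }

/-- Uniform description of a polygonal curve with at least one (possibly degenerate) edge. -/
structure PLData {d : ℕ} (O : Set (Set (Euc d))) (P : ℝ → Euc d) (n : ℕ) (q : ℕ → Euc d) :
    Prop where
  pos : 0 < n
  vert : ∀ i ≤ n, {q i} ∈ O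
  edge : ∀ i < n, segment ℝ (q i) (q (i + 1)) ∈ O
  formula : ∀ i < n, ∀ u : ℝ, (i : ℝ) ≤ u * n → u * n ≤ i + 1 →
    P u = (1 - (u * n - i)) • q i + (u * n - i) • q (i + 1)

/-- Separation of the objects: a vertex close to an object lies on it. -/
structure ObjSep {d : ℕ} (O : Set (Set (Euc d))) (m : ℝ) : Prop where
  vv : ∀ x y : Euc d, {x} ∈ O → {y} ∈ O → dist x y < m → x = y
  ve : ∀ x a b y : Euc d, {x} ∈ O → segment ℝ a b ∈ O → y ∈ segment ℝ a b →
    dist y x < m → x ∈ segment ℝ a b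

/-- The snapping relation. -/
def Snap {d : ℕ} (P : ℝ → Euc d) (n : ℕ) (q : ℕ → Euc d) (u : ℝ) (x : Euc d) (y : ℝ) : Prop :=
  ∃ i < n, (i : ℝ) ≤ u * n ∧ u * n ≤ i + 1 ∧ (i : ℝ) ≤ y * n ∧ y * n ≤ i + 1 ∧ P y = x ∧
    (q i = q (i + 1) → y = u)

lemma exists_plData {d : ℕ} (S : Finset (Σ n : ℕ, Fin (n + 1) → Euc d))
    (s : Σ n : ℕ, Fin (n + 1) → Euc d) (hs : s ∈ S) :
    ∃ n q, PLData (objects S) (curveMap s.2) n q := by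
  obtain ⟨n, p⟩ := s
  rcases Nat.eq_zero_or_pos n with h0 | hn
  · subst h0
    refine ⟨1, fun _ => p 0, one_pos, ?_, ?_, ?_⟩
    · intro i _
      exact ⟨_, hs, Or.inl ⟨0, rfl⟩⟩
    · intro i _
      exact ⟨_, hs, Or.inl ⟨0, by simp⟩⟩
    · intro i _ u _ _
      simp only [curveMap, dif_pos]
      rw [← add_smul]; simp
  · refine ⟨n, fun i => if h : i < n + 1 then p ⟨i, h⟩ else p 0, hn, ?_, ?_, ?_⟩
    · intro i hi
      refine ⟨_, hs, Or.inl ⟨⟨i, by simpa using Nat.lt_succ_of_le hi⟩, ?_⟩⟩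
      simp [Nat.lt_succ_of_le hi]
    · intro i hi
      refine ⟨_, hs, Or.inr ⟨⟨i, hi⟩, ?_⟩⟩
      have h1 : i < n + 1 := by omega
      have h2 : i + 1 < n + 1 := by omega
      simp only [dif_pos h1, dif_pos h2]
      rfl
    · intro i hi u h1 h2
      have g1 : i < n + 1 := by omega
      have g2 : i + 1 < n + 1 := by omega
      simp only [dif_pos g1, dif_pos g2, curveMap, dif_neg hn.ne']
      have hu0 : 0 ≤ u * n := le_trans (by positivity) h1
      rcases lt_or_eq_of_le h2 with h2 | h2
      · have hf : ⌊u * (n : ℝ)⌋₊ = i := (Nat.floor_eq_iff hu0).2 ⟨h1, h2⟩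
        have hm : min ⌊u * (n : ℝ)⌋₊ (n - 1) = i := by rw [hf]; omega
        simp only [hm]
      · have hf : ⌊u * (n : ℝ)⌋₊ = i + 1 := by
          rw [h2]; exact_mod_cast Nat.floor_natCast (i + 1)
        by_cases hin : i + 1 ≤ n - 1
        · have hm : min ⌊u * (n : ℝ)⌋₊ (n - 1) = i + 1 := by rw [hf]; omega
          simp only [hm]
          have c1 : u * (n : ℝ) - ((i + 1 : ℕ) : ℝ) = 0 := by push_cast; linarith
          have c2 : u * (n : ℝ) - (i : ℝ) = 1 := by linarith
          rw [c1, c2]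
          simp
        · have hm : min ⌊u * (n : ℝ)⌋₊ (n - 1) = i := by rw [hf]; omega
          simp only [hm]

lemma PLData.vertex {d : ℕ} {O : Set (Set (Euc d))} {P : ℝ → Euc d} {n : ℕ} {q : ℕ → Euc d}
    (h : PLData O P n q) {u : ℝ} {j : ℕ} (hj : j ≤ n) (hu : u * n = j) : P u = q j := by
  rcases Nat.lt_or_ge j n with h1 | h1
  · rw [h.formula j h1 u (by linarith) (by linarith), hu]; simp
  · obtain ⟨i, rfl⟩ : ∃ i, j = i + 1 := ⟨j - 1, by have := h.pos; omega⟩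
    push_cast at hu
    rw [h.formula i (by omega) u (by linarith) (by linarith), hu]; simp

lemma PLData.dist_eq {d : ℕ} {O : Set (Set (Euc d))} {P : ℝ → Euc d} {n : ℕ} {q : ℕ → Euc d}
    (h : PLData O P n q) {i : ℕ} (hi : i < n) {u v : ℝ}
    (h1 : (i : ℝ) ≤ u * n) (h2 : u * n ≤ i + 1) (h3 : (i : ℝ) ≤ v * n) (h4 : v * n ≤ i + 1) :
    dist (P u) (P v) = |u - v| * (n * dist (q i) (q (i + 1))) := by
  rw [h.formula i hi u h1 h2, h.formula i hi v h3 h4, dist_eq_norm, dist_eq_norm]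
  have : (1 - (u * n - i)) • q i + (u * n - i) • q (i + 1)
      - ((1 - (v * n - i)) • q i + (v * n - i) • q (i + 1))
      = ((v - u) * (n : ℝ)) • (q i - q (i + 1)) := by module
  rw [this, norm_smul, Real.norm_eq_abs, abs_mul, abs_sub_comm, Nat.abs_cast]
  ring

lemma Snap.of_int {d : ℕ} {O : Set (Set (Euc d))} {P : ℝ → Euc d} {n : ℕ} {q : ℕ → Euc d}
    (h : PLData O P n q) {m r : ℝ} (hS : ObjSep O m) (hr : r < m) {u : ℝ} {x : Euc d} {y : ℝ}
    (hx : {x} ∈ O) (hd : dist (P u) x ≤ r) (hsn : Snap P n q u x y)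
    {j : ℕ} (hj : j ≤ n) (hu : u * n = j) : y = u := by
  obtain ⟨i, hi, h1, h2, h3, h4, h5, h6⟩ := hsn
  have hPu := h.vertex hj hu
  have hxq : q j = x := hS.vv _ _ (h.vert j hj) hx (by rw [← hPu]; linarith)
  have hde := h.dist_eq hi h1 h2 h3 h4
  rw [hPu, h5, hxq, dist_self] at hde
  by_cases hq : q i = q (i + 1)
  · exact h6 hq
  · have hp : 0 < (n : ℝ) * dist (q i) (q (i + 1)) :=
      mul_pos (by exact_mod_cast h.pos) (dist_pos.2 hq)
    have : |u - y| = 0 := by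
      rcases mul_eq_zero.1 hde.symm with h | h
      · exact h
      · exact absurd h hp.ne'
    have := abs_eq_zero.1 this
    linarith

lemma Snap.mem_edge {d : ℕ} {O : Set (Set (Euc d))} {P : ℝ → Euc d} {n : ℕ} {q : ℕ → Euc d}
    (h : PLData O P n q) {m r : ℝ} (hS : ObjSep O m) (hr : r < m) {u : ℝ} {x : Euc d} {y : ℝ}
    (hx : {x} ∈ O) (hd : dist (P u) x ≤ r) (hsn : Snap P n q u x y)
    {j : ℕ} (hj : j < n) (hu1 : (j : ℝ) ≤ u * n) (hu2 : u * n ≤ j + 1) :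
    (j : ℝ) ≤ y * n ∧ y * n ≤ j + 1 := by
  have hsn' := hsn
  obtain ⟨i, hi, h1, h2, h3, h4, h5, h6⟩ := hsn
  rcases lt_trichotomy i j with hij | hij | hij
  · have : (i : ℝ) + 1 ≤ j := by exact_mod_cast hij
    have := hsn'.of_int h hS hr hx hd hj.le (by linarith)
    rw [this]; exact ⟨hu1, hu2⟩
  · subst hij; exact ⟨h3, h4⟩
  · have : (j : ℝ) + 1 ≤ i := by exact_mod_cast hij
    have := hsn'.of_int h hS hr hx hd hi.le (by linarith)
    rw [this]; exact ⟨hu1, hu2⟩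

lemma Snap.mono {d : ℕ} {O : Set (Set (Euc d))} {P : ℝ → Euc d} {n : ℕ} {q : ℕ → Euc d}
    (h : PLData O P n q) {m r : ℝ} (hS : ObjSep O m) (hr0 : 0 ≤ r) (hr : 2 * r < m)
    {u u' : ℝ} {x x' : Euc d} {y y' : ℝ}
    (hx : {x} ∈ O) (hd : dist (P u) x ≤ r) (hsn : Snap P n q u x y)
    (hx' : {x'} ∈ O) (hd' : dist (P u') x' ≤ r) (hsn' : Snap P n q u' x' y')
    (huu : u ≤ u') : y ≤ y' := by
  have hn : (0 : ℝ) < n := by exact_mod_cast h.pos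
  obtain ⟨i', hi', g1, g2, g3, g4, g5, g6⟩ := id hsn'
  obtain ⟨i, hi, h1, h2, h3, h4, h5, h6⟩ := id hsn
  have huun : u * n ≤ u' * n := mul_le_mul_of_nonneg_right huu hn.le
  rcases lt_trichotomy i i' with hij | hij | hij
  · have : (i : ℝ) + 1 ≤ i' := by exact_mod_cast hij
    exact le_of_mul_le_mul_right (by linarith) hn
  · subst hij
    by_cases hq : q i = q (i + 1)
    · rw [h6 hq, g6 hq]; exact huu
    · have hp : 0 < (n : ℝ) * dist (q i) (q (i + 1)) := mul_pos hn (dist_pos.2 hq)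
      by_contra hlt
      push Not at hlt
      have e1 := h.dist_eq hi h1 h2 h3 h4
      have e2 := h.dist_eq hi g1 g2 g3 g4
      have e3 := h.dist_eq hi h3 h4 g3 g4
      set c := (n : ℝ) * dist (q i) (q (i + 1)) with hc
      rw [h5] at e1 e3
      rw [g5] at e2 e3
      have b1 : (y - u) * c ≤ r := by
        have := mul_le_mul_of_nonneg_right (neg_abs_le (u - y)) hp.le
        linarith
      have b2 : (u' - y') * c ≤ r := by
        have := mul_le_mul_of_nonneg_right (le_abs_self (u' - y')) hp.le
        linarith
      have b3 : (u - u') * c ≤ 0 := mul_nonpos_of_nonpos_of_nonneg (by linarith) hp.le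
      rw [abs_of_pos (by linarith)] at e3
      have hxx : x = x' := hS.vv _ _ hx hx' (by rw [e3]; nlinarith)
      rw [hxx, dist_self] at e3
      have := mul_pos (sub_pos.2 hlt) hp
      linarith
  · have : (i' : ℝ) + 1 ≤ i := by exact_mod_cast hij
    rw [hsn.of_int h hS (by linarith) hx hd hi.le (by linarith),
      hsn'.of_int h hS (by linarith) hx' hd' hi.le (by linarith)]
    exact huu

lemma exists_edge {n : ℕ} (hn : 0 < n) {u : ℝ} (hu : u ∈ Icc (0 : ℝ) 1) :
    ∃ i < n, (i : ℝ) ≤ u * n ∧ u * n ≤ i + 1 ∧ (u * n < i + 1 ∨ i + 1 = n) := by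
  have hn' : (0 : ℝ) < n := by exact_mod_cast hn
  have hun : u * n ≤ n := by nlinarith [hu.2]
  have hu0 : 0 ≤ u * n := mul_nonneg hu.1 hn'.le
  rcases lt_or_eq_of_le hun with h | h
  · refine ⟨⌊u * n⌋₊, ?_, Nat.floor_le hu0, (Nat.lt_floor_add_one _).le,
      Or.inl (Nat.lt_floor_add_one _)⟩
    exact (Nat.floor_lt hu0).2 h
  · refine ⟨n - 1, by omega, ?_, ?_, Or.inr (by omega)⟩
    · rw [h]; exact_mod_cast Nat.sub_le _ _
    · rw [h]; exact_mod_cast (by omega : n ≤ n - 1 + 1)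

lemma exists_snap {d : ℕ} {O : Set (Set (Euc d))} {P : ℝ → Euc d} {n : ℕ} {q : ℕ → Euc d}
    (h : PLData O P n q) {m r : ℝ} (hS : ObjSep O m) (hr : r < m) {u : ℝ} (hu : u ∈ Icc (0 : ℝ) 1)
    {x : Euc d} (hx : {x} ∈ O) (hd : dist (P u) x ≤ r) : ∃ y, Snap P n q u x y := by
  have hn : (0 : ℝ) < n := by exact_mod_cast h.pos
  obtain ⟨i, hi, h1, h2, -⟩ := exists_edge h.pos hu
  have hPu := h.formula i hi u h1 h2
  have hmem : P u ∈ segment ℝ (q i) (q (i + 1)) := by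
    rw [hPu]
    exact ⟨_, _, by linarith, by linarith, by ring, rfl⟩
  have hxm := hS.ve x _ _ _ hx (h.edge i hi) hmem (by linarith)
  by_cases hq : q i = q (i + 1)
  · refine ⟨u, i, hi, h1, h2, h1, h2, ?_, fun _ => rfl⟩
    rw [← hq, segment_same] at hxm hmem
    rw [mem_singleton_iff] at hxm hmem
    rw [hxm, hmem]
  · obtain ⟨a, b, ha, hb, hab, rfl⟩ := hxm
    have e : (i + b) / n * (n : ℝ) = i + b := by field_simp
    refine ⟨(i + b) / n, i, hi, h1, h2, by linarith, by linarith, ?_, fun hh => absurd hh hq⟩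
    rw [h.formula i hi _ (by linarith) (by linarith), e]
    have : a = 1 - b := by linarith
    subst this
    congr 2 <;> ring

/-- Piecewise linear interpolation of `a 0, …, a N` over `[0,1]`. -/
def interp (a : ℕ → ℝ) (N : ℕ) (t : ℝ) : ℝ :=
  a 0 + ∑ k ∈ Finset.range N, (a (k + 1) - a k) * max 0 (min 1 (t * N - k))

lemma interp_eq (a : ℕ → ℝ) (N k : ℕ) (hk : k < N) (t : ℝ) (h1 : (k : ℝ) ≤ t * N)
    (h2 : t * N ≤ k + 1) : interp a N t = (1 - (t * N - k)) * a k + (t * N - k) * a (k + 1) := by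
  unfold interp
  obtain ⟨l, rfl⟩ : ∃ l, N = k + (1 + l) := ⟨N - k - 1, by omega⟩
  rw [Finset.sum_range_add, Finset.sum_range_add]
  have e1 : ∑ x ∈ Finset.range k, (a (x + 1) - a x) * max 0 (min 1 (t * (k + (1 + l) : ℕ) - x))
      = a k - a 0 := by
    rw [← Finset.sum_range_sub]
    refine Finset.sum_congr rfl fun x hx => ?_
    have : (x : ℝ) + 1 ≤ k := by exact_mod_cast Finset.mem_range.1 hx
    rw [min_eq_left (by linarith)]; simp
  have e2 : ∑ x ∈ Finset.range l, (a (k + (1 + x) + 1) - a (k + (1 + x))) *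
      max 0 (min 1 (t * (k + (1 + l) : ℕ) - ((k + (1 + x) : ℕ) : ℝ))) = 0 := by
    refine Finset.sum_eq_zero fun x _ => ?_
    have : ((k + (1 + x) : ℕ) : ℝ) ≥ k + 1 := by push_cast; linarith [Nat.cast_nonneg (α := ℝ) x]
    rw [max_eq_left, mul_zero]
    exact (min_le_right _ _).trans (by linarith)
  rw [e1, e2]
  simp only [Finset.sum_range_one, add_zero]
  rw [min_eq_right (by linarith), max_eq_right (by linarith)]
  ring

lemma interp_isRepar (a : ℕ → ℝ) (N : ℕ) (hN : 0 < N) (h0 : a 0 = 0) (h1 : a N = 1)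
    (hm : ∀ k < N, a k ≤ a (k + 1)) : IsRepar (interp a N) := by
  have hN' : (0 : ℝ) < N := by exact_mod_cast hN
  have hc : Continuous (interp a N) := by unfold interp; fun_prop
  have hmono : Monotone (interp a N) := by
    intro s t hst
    unfold interp
    gcongr with k hk
    exact sub_nonneg.2 (hm k (Finset.mem_range.1 hk))
  have e0 : interp a N 0 = 0 := by
    rw [interp_eq a N 0 hN 0 (by simp) (by simp)]; simp [h0]
  have e1 : interp a N 1 = 1 := by
    obtain ⟨M, rfl⟩ : ∃ M, N = M + 1 := ⟨N - 1, by omega⟩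
    rw [interp_eq a (M + 1) M (by omega) 1 (by push_cast; linarith) (by push_cast; linarith), h1]
    push_cast; ring
  refine ⟨hc.continuousOn, hmono.monotoneOn _, Subset.antisymm ?_ ?_⟩
  · rintro _ ⟨t, ht, rfl⟩
    exact ⟨e0 ▸ hmono ht.1, e1 ▸ hmono ht.2⟩
  · have := intermediate_value_Icc (zero_le_one' ℝ) hc.continuousOn
    rwa [e0, e1] at this

lemma IsRepar.zero {f : ℝ → ℝ} (h : IsRepar f) : f 0 = 0 := by
  obtain ⟨-, hm, hi⟩ := h
  have h0 : (0 : ℝ) ∈ Icc (0 : ℝ) 1 := by simp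
  obtain ⟨t, ht, hft⟩ : (0 : ℝ) ∈ f '' Icc 0 1 := by rw [hi]; exact h0
  have h1 : f 0 ∈ Icc (0 : ℝ) 1 := hi ▸ mem_image_of_mem f h0
  exact le_antisymm (hft ▸ hm h0 ht ht.1) h1.1

lemma IsRepar.one {f : ℝ → ℝ} (h : IsRepar f) : f 1 = 1 := by
  obtain ⟨-, hm, hi⟩ := h
  have h0 : (1 : ℝ) ∈ Icc (0 : ℝ) 1 := by simp
  obtain ⟨t, ht, hft⟩ : (1 : ℝ) ∈ f '' Icc 0 1 := by rw [hi]; exact h0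
  have h1 : f 1 ∈ Icc (0 : ℝ) 1 := hi ▸ mem_image_of_mem f h0
  exact le_antisymm h1.2 (hft.symm.trans_le (hm ht h0 ht.2))

lemma IsRepar.mem {f : ℝ → ℝ} (h : IsRepar f) {t : ℝ} (ht : t ∈ Icc (0 : ℝ) 1) :
    f t ∈ Icc (0 : ℝ) 1 := h.2.2 ▸ mem_image_of_mem f ht

/-- Times at which the reparametrized curve passes the vertices. -/
lemma exists_events {f : ℝ → ℝ} (h : IsRepar f) {n : ℕ} (hn : 0 < n) :
    ∃ T : Finset ℝ, (∀ t ∈ T, t ∈ Icc (0 : ℝ) 1 ∧ ∃ j ≤ n, f t * n = j) ∧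
      0 ∈ T ∧ 1 ∈ T ∧ ∀ j ≤ n, ∃ t ∈ T, f t * n = j := by
  have hn' : (0 : ℝ) < n := by exact_mod_cast hn
  have key : ∀ j : ℕ, ∃ t : ℝ, j ≤ n → t ∈ Icc (0 : ℝ) 1 ∧ f t * n = j := by
    intro j
    by_cases hj : j ≤ n
    · have : (j / n : ℝ) ∈ f '' Icc 0 1 := by
        rw [h.2.2]
        exact ⟨by positivity, (div_le_one hn').2 (by exact_mod_cast hj)⟩
      obtain ⟨t, ht, hft⟩ := this
      exact ⟨t, fun _ => ⟨ht, by rw [hft]; field_simp⟩⟩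
    · exact ⟨0, fun h => absurd h hj⟩
  choose τ hτ using key
  refine ⟨insert 0 (insert 1 ((Finset.range (n + 1)).image τ)), ?_, by simp, by simp, ?_⟩
  · intro t ht
    simp only [Finset.mem_insert, Finset.mem_image, Finset.mem_range] at ht
    rcases ht with rfl | rfl | ⟨j, hj, rfl⟩
    · exact ⟨by simp, 0, by omega, by rw [h.zero]; simp⟩
    · exact ⟨by simp, n, le_rfl, by rw [h.one]; simp⟩
    · exact ⟨(hτ j (by omega)).1, j, by omega, (hτ j (by omega)).2⟩
  · intro j hj
    refine ⟨τ j, ?_, (hτ j hj).2⟩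
    simp only [Finset.mem_insert, Finset.mem_image, Finset.mem_range]
    exact Or.inr (Or.inr ⟨j, by omega, rfl⟩)

lemma snap_affine {d : ℕ} {O : Set (Set (Euc d))} {P : ℝ → Euc d} {n : ℕ} {q : ℕ → Euc d}
    (h : PLData O P n q) {m r : ℝ} (hS : ObjSep O m) (hr : r < m) {f : ℝ → ℝ} (hf : IsRepar f)
    {T : Finset ℝ} (hT : ∀ t ∈ T, t ∈ Icc (0 : ℝ) 1)
    (hTn : ∀ j ≤ n, ∃ t ∈ T, f t * n = j) {t t' : ℝ} (ht : t ∈ T) (ht' : t' ∈ T)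
    (hnone : ∀ s ∈ T, ¬ (t < s ∧ s < t')) (htt : t ≤ t')
    {x x' : Euc d} {y y' : ℝ}
    (hx : {x} ∈ O) (hd : dist (P (f t)) x ≤ r) (hsn : Snap P n q (f t) x y)
    (hx' : {x'} ∈ O) (hd' : dist (P (f t')) x' ≤ r) (hsn' : Snap P n q (f t') x' y')
    {l : ℝ} (hl0 : 0 ≤ l) (hl1 : l ≤ 1) :
    P ((1 - l) * y + l * y') = (1 - l) • x + l • x' := by
  have hn : (0 : ℝ) < n := by exact_mod_cast h.pos
  obtain ⟨i, hi, h1, h2, h3⟩ := exists_edge h.pos (hf.mem (hT t ht))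
  have hle : f t * n ≤ f t' * n :=
    mul_le_mul_of_nonneg_right (hf.2.1 (hT t ht) (hT t' ht') htt) hn.le
  have h4 : f t' * n ≤ i + 1 := by
    by_contra hlt
    push Not at hlt
    rcases h3 with h3 | h3
    · obtain ⟨s, hs, hfs⟩ := hTn (i + 1) hi
      push_cast at hfs
      apply hnone s hs
      constructor
      · by_contra hh
        push Not at hh
        have := mul_le_mul_of_nonneg_right (hf.2.1 (hT s hs) (hT t ht) hh) hn.le
        linarith
      · by_contra hh
        push Not at hh
        have := mul_le_mul_of_nonneg_right (hf.2.1 (hT t' ht') (hT s hs) hh) hn.le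
        linarith
    · have : (i : ℝ) + 1 = n := by exact_mod_cast h3
      have := mul_le_mul_of_nonneg_right (hf.mem (hT t' ht')).2 hn.le
      linarith
  obtain ⟨a1, a2⟩ := hsn.mem_edge h hS hr hx hd hi h1 h2
  obtain ⟨b1, b2⟩ := hsn'.mem_edge h hS hr hx' hd' hi (h1.trans hle) h4
  have hPy : P y = x := by obtain ⟨_, _, _, _, _, _, h5, _⟩ := hsn; exact h5
  have hPy' : P y' = x' := by obtain ⟨_, _, _, _, _, _, h5, _⟩ := hsn'; exact h5
  rw [← hPy, ← hPy', h.formula i hi y a1 a2, h.formula i hi y' b1 b2, h.formula i hi]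
  · module
  · nlinarith
  · nlinarith

lemma frechet_zero {d : ℕ} {O : Set (Set (Euc d))} {m r : ℝ} (hS : ObjSep O m) (hr0 : 0 ≤ r)
    (hr : 2 * r < m) {P Q : ℝ → Euc d} {n n' : ℕ} {q q' : ℕ → Euc d}
    (hP : PLData O P n q) (hQ : PLData O Q n' q') {f g : ℝ → ℝ} (hf : IsRepar f)
    (hg : IsRepar g) (hfg : ∀ t ∈ Icc (0 : ℝ) 1, dist (P (f t)) (Q (g t)) ≤ r) :
    ∃ f g : ℝ → ℝ, IsRepar f ∧ IsRepar g ∧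
      ∀ t ∈ Icc (0 : ℝ) 1, dist (P (f t)) (Q (g t)) ≤ 0 := by
  obtain ⟨T₁, hT₁, z1, o1, c1⟩ := exists_events hf hP.pos
  obtain ⟨T₂, hT₂, z2, o2, c2⟩ := exists_events hg hQ.pos
  have hrm : r < m := by linarith
  obtain ⟨T, hTdef⟩ : ∃ T : Finset ℝ, T = T₁ ∪ T₂ := ⟨_, rfl⟩
  have hT : ∀ t ∈ T, t ∈ Icc (0 : ℝ) 1 := by
    intro t ht
    rw [hTdef, Finset.mem_union] at ht
    exact ht.elim (fun h => (hT₁ t h).1) (fun h => (hT₂ t h).1)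
  have hc1 : ∀ j ≤ n, ∃ t ∈ T, f t * n = j := fun j hj => by
    obtain ⟨t, ht, e⟩ := c1 j hj
    exact ⟨t, by rw [hTdef]; exact Finset.mem_union_left _ ht, e⟩
  have hc2 : ∀ j ≤ n', ∃ t ∈ T, g t * n' = j := fun j hj => by
    obtain ⟨t, ht, e⟩ := c2 j hj
    exact ⟨t, by rw [hTdef]; exact Finset.mem_union_right _ ht, e⟩
  have hT0 : (0 : ℝ) ∈ T := by rw [hTdef]; exact Finset.mem_union_left _ z1
  have hT1 : (1 : ℝ) ∈ T := by rw [hTdef]; exact Finset.mem_union_left _ o1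
  -- the snapped points
  have key : ∀ t : ℝ, ∃ (x : Euc d) (y z : ℝ), t ∈ T → {x} ∈ O ∧ dist (P (f t)) x ≤ r ∧
      dist (Q (g t)) x ≤ r ∧ Snap P n q (f t) x y ∧ Snap Q n' q' (g t) x z := by
    intro t
    by_cases ht : t ∈ T
    · have hx : ∃ x : Euc d, {x} ∈ O ∧ dist (P (f t)) x ≤ r ∧ dist (Q (g t)) x ≤ r := by
        have ht' := ht
        rw [hTdef, Finset.mem_union] at ht'
        rcases ht' with h | h
        · obtain ⟨-, j, hj, e⟩ := hT₁ t h
          refine ⟨q j, hP.vert j hj, ?_, ?_⟩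
          · rw [hP.vertex hj e, dist_self]; exact hr0
          · rw [← hP.vertex hj e, dist_comm]; exact hfg t (hT t ht)
        · obtain ⟨-, j, hj, e⟩ := hT₂ t h
          refine ⟨q' j, hQ.vert j hj, ?_, ?_⟩
          · rw [← hQ.vertex hj e]; exact hfg t (hT t ht)
          · rw [hQ.vertex hj e, dist_self]; exact hr0
      obtain ⟨x, hx, h1, h2⟩ := hx
      obtain ⟨y, hy⟩ := exists_snap hP hS hrm (hf.mem (hT t ht)) hx h1
      obtain ⟨z, hz⟩ := exists_snap hQ hS hrm (hg.mem (hT t ht)) hx h2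
      exact ⟨x, y, z, fun _ => ⟨hx, h1, h2, hy, hz⟩⟩
    · exact ⟨0, 0, 0, fun h => absurd h ht⟩
  choose x F G hFG using key
  -- sorting the events
  have hcard : 1 < T.card := Finset.one_lt_card.2 ⟨0, hT0, 1, hT1, zero_ne_one⟩
  obtain ⟨N, hN⟩ : ∃ N, T.card = N + 1 := ⟨T.card - 1, by omega⟩
  have hN0 : 0 < N := by omega
  have hNR : (0 : ℝ) < N := by exact_mod_cast hN0
  let em := T.orderEmbOfFin hN
  let e : ℕ → ℝ := fun k => if h : k < N + 1 then em ⟨k, h⟩ else 0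
  have he : ∀ k (h : k < N + 1), e k = em ⟨k, h⟩ := fun k h => dif_pos h
  have heT : ∀ k ≤ N, e k ∈ T := fun k hk => by
    rw [he k (by omega)]; exact Finset.orderEmbOfFin_mem _ _ _
  have hsurj : ∀ s ∈ T, ∃ k, ∃ h : k < N + 1, em ⟨k, h⟩ = s := by
    intro s hs
    have : s ∈ Set.range em := by
      rw [Finset.range_orderEmbOfFin]; exact hs
    obtain ⟨⟨k, hk⟩, h⟩ := this
    exact ⟨k, hk, h⟩
  have hstep : ∀ k < N, e k ≤ e (k + 1) := by
    intro k hk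
    rw [he k (by omega), he (k + 1) (by omega)]
    apply em.monotone
    simp
  have hnone : ∀ k < N, ∀ s ∈ T, ¬ (e k < s ∧ s < e (k + 1)) := by
    rintro k hk s hs ⟨h1, h2⟩
    obtain ⟨j, hj, rfl⟩ := hsurj s hs
    rw [he k (by omega), em.lt_iff_lt, Fin.mk_lt_mk] at h1
    rw [he (k + 1) (by omega), em.lt_iff_lt, Fin.mk_lt_mk] at h2
    omega
  have he0 : e 0 = 0 := by
    obtain ⟨j, hj, h⟩ := hsurj 0 hT0
    refine le_antisymm ?_ (hT _ (heT 0 (by omega))).1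
    rw [he 0 (by omega), ← h]
    apply em.monotone
    simp
  have he1 : e N = 1 := by
    obtain ⟨j, hj, h⟩ := hsurj 1 hT1
    refine le_antisymm (hT _ (heT N le_rfl)).2 ?_
    rw [he N (by omega), ← h]
    apply em.monotone
    rw [Fin.mk_le_mk]; omega
  refine ⟨interp (fun k => F (e k)) N, interp (fun k => G (e k)) N, ?_, ?_, ?_⟩
  · apply interp_isRepar _ _ hN0
    · obtain ⟨h1, h2, h3, h4, h5⟩ := hFG 0 hT0
      simp only [he0]
      have := h4.of_int hP hS hrm h1 h2 (j := 0) (by omega) (by rw [hf.zero]; simp)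
      rw [this, hf.zero]
    · obtain ⟨h1, h2, h3, h4, h5⟩ := hFG 1 hT1
      simp only [he1]
      have := h4.of_int hP hS hrm h1 h2 (j := n) le_rfl (by rw [hf.one]; simp)
      rw [this, hf.one]
    · intro k hk
      have m1 := heT k (by omega)
      have m2 := heT (k + 1) (by omega)
      obtain ⟨h1, h2, h3, h4, h5⟩ := hFG _ m1
      obtain ⟨g1, g2, g3, g4, g5⟩ := hFG _ m2
      exact h4.mono hP hS hr0 hr h1 h2 g1 g2 g4 (hf.2.1 (hT _ m1) (hT _ m2) (hstep k hk))
  · apply interp_isRepar _ _ hN0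
    · obtain ⟨h1, h2, h3, h4, h5⟩ := hFG 0 hT0
      simp only [he0]
      have := h5.of_int hQ hS hrm h1 h3 (j := 0) (by omega) (by rw [hg.zero]; simp)
      rw [this, hg.zero]
    · obtain ⟨h1, h2, h3, h4, h5⟩ := hFG 1 hT1
      simp only [he1]
      have := h5.of_int hQ hS hrm h1 h3 (j := n') le_rfl (by rw [hg.one]; simp)
      rw [this, hg.one]
    · intro k hk
      have m1 := heT k (by omega)
      have m2 := heT (k + 1) (by omega)
      obtain ⟨h1, h2, h3, h4, h5⟩ := hFG _ m1
      obtain ⟨g1, g2, g3, g4, g5⟩ := hFG _ m2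
      exact h5.mono hQ hS hr0 hr h1 h3 g1 g3 g5 (hg.2.1 (hT _ m1) (hT _ m2) (hstep k hk))
  · intro t ht
    obtain ⟨k, hk, k1, k2, -⟩ := exists_edge hN0 ht
    rw [interp_eq _ N k hk t k1 k2, interp_eq _ N k hk t k1 k2]
    have m1 := heT k (by omega)
    have m2 := heT (k + 1) (by omega)
    obtain ⟨h1, h2, h3, h4, h5⟩ := hFG _ m1
    obtain ⟨g1, g2, g3, g4, g5⟩ := hFG _ m2
    rw [snap_affine hP hS hrm hf hT hc1 m1 m2 (hnone k hk) (hstep k hk) h1 h2 h4 g1 g2 g4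
        (by linarith) (by linarith),
      snap_affine hQ hS hrm hg hT hc2 m1 m2 (hnone k hk) (hstep k hk) h1 h3 h5 g1 g3 g5
        (by linarith) (by linarith), dist_self]

lemma objects_finite {d : ℕ} (S : Finset (Σ n : ℕ, Fin (n + 1) → Euc d)) :
    (objects S).Finite := by
  have : objects S ⊆ ⋃ s ∈ (S : Set (Σ n : ℕ, Fin (n + 1) → Euc d)),
      (range (fun i : Fin (s.1 + 1) => ({s.2 i} : Set (Euc d))) ∪
        range (fun i : Fin s.1 => segment ℝ (s.2 i.castSucc) (s.2 i.succ))) := by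
    rintro A ⟨s, hs, h⟩
    refine mem_biUnion (Finset.mem_coe.2 hs) ?_
    rcases h with ⟨i, rfl⟩ | ⟨i, rfl⟩
    · exact Or.inl ⟨i, rfl⟩
    · exact Or.inr ⟨i, rfl⟩
  refine Set.Finite.subset (Set.Finite.biUnion S.finite_toSet fun s _ => ?_) this
  exact (finite_range _).union (finite_range _)

lemma objDists_finite {d : ℕ} (S : Finset (Σ n : ℕ, Fin (n + 1) → Euc d)) :
    { r : ℝ | ∃ A ∈ objects S, ∃ B ∈ objects S, setDist A B = r }.Finite := by
  have := (objects_finite S).image2 setDist (objects_finite S)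
  exact this.subset (by rintro r ⟨A, hA, B, hB, rfl⟩; exact ⟨A, hA, B, hB, rfl⟩)

lemma setDist_nonneg {d : ℕ} (A B : Set (Euc d)) : 0 ≤ setDist A B :=
  Real.sInf_nonneg (by rintro _ ⟨a, _, b, _, rfl⟩; exact dist_nonneg)

lemma setDist_le {d : ℕ} {A B : Set (Euc d)} {a b : Euc d} (ha : a ∈ A) (hb : b ∈ B) :
    setDist A B ≤ dist a b :=
  csInf_le ⟨0, by rintro _ ⟨a, _, b, _, rfl⟩; exact dist_nonneg⟩ ⟨a, ha, b, hb, rfl⟩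

lemma setDist_singleton {d : ℕ} (a b : Euc d) : setDist {a} {b} = dist a b := by
  simp [setDist]

lemma mem_of_setDist {d : ℕ} {x : Euc d} {B : Set (Euc d)} (hB : IsClosed B)
    (hne : B.Nonempty) (h : setDist {x} B = 0) : x ∈ B := by
  rw [hB.mem_iff_infDist_zero hne]
  refine le_antisymm ?_ infDist_nonneg
  rw [← h]
  obtain ⟨b, hb⟩ := hne
  refine le_csInf ⟨_, x, rfl, b, hb, rfl⟩ ?_
  rintro _ ⟨a, rfl, c, hc, rfl⟩
  exact infDist_le_dist_of_mem hc

lemma sep_objects {d : ℕ} (S : Finset (Σ n : ℕ, Fin (n + 1) → Euc d)) :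
    ObjSep (objects S) (minPosObjDist S) := by
  have key : ∀ A ∈ objects S, ∀ B ∈ objects S, setDist A B < minPosObjDist S →
      setDist A B = 0 := by
    intro A hA B hB h
    by_contra hne
    have hpos := lt_of_le_of_ne (setDist_nonneg A B) (Ne.symm hne)
    exact absurd h (not_lt.2 (csInf_le ⟨0, fun r hr => hr.2.le⟩ ⟨⟨A, hA, B, hB, rfl⟩, hpos⟩))
  constructor
  · intro x y hx hy h
    have := key _ hx _ hy (by rwa [setDist_singleton])
    rwa [setDist_singleton, dist_eq_zero] at this
  · intro x a b y hx hs hy h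
    refine mem_of_setDist ?_ ⟨y, hy⟩ (key _ hx _ hs ?_)
    · rw [← convexHull_pair (𝕜 := ℝ)]
      exact ((Set.toFinite {a, b}).isCompact_convexHull ℝ).isClosed
    · refine lt_of_le_of_lt (setDist_le rfl hy) ?_
      rwa [dist_comm]

/-- Lemma 5.3 of the paper. The reciprocal of the bundledness of a set `S`
of polygonal curves is `O(Φ(S))`: the ratio of the maximal edge length to the minimal
pairwise Fréchet distance is at most a universal constant times the spread of the collection
of vertices and edges of the curves in `S`. -/
theorem bundledness_le_spread :
    ∃ C : ℝ, 0 < C ∧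
      ∀ (d k : ℕ), 1 ≤ d → 1 ≤ k →
      ∀ S : Finset (Σ n : ℕ, Fin (n + 1) → Euc d),
        2 ≤ S.card →
        (∀ s ∈ S, s.1 + 1 ≤ k) →
        (∀ s ∈ S, ∀ s' ∈ S, s ≠ s' →
          0 < frechetDist (curveMap s.2) (curveMap s'.2)) →
        (∃ A ∈ objects S, ∃ B ∈ objects S, 0 < setDist A B) →
        maxEdgeLen S / minFrechet S ≤ C * spread S := by
  refine ⟨2, two_pos, ?_⟩
  intro d k _ _ S hcard _ hpos hobj
  -- minimal positive object distance
  have hm : 0 < minPosObjDist S := by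
    have hfin : { r : ℝ | (∃ A ∈ objects S, ∃ B ∈ objects S, setDist A B = r) ∧ 0 < r }.Finite :=
      (objDists_finite S).subset fun r hr => hr.1
    obtain ⟨A, hA, B, hB, h⟩ := hobj
    have hne : { r : ℝ | (∃ A ∈ objects S, ∃ B ∈ objects S, setDist A B = r) ∧ 0 < r }.Nonempty :=
      ⟨_, ⟨A, hA, B, hB, rfl⟩, h⟩
    exact (hne.csInf_mem hfin).2
  have hbdd := (objDists_finite S).bddAbove
  have hM0 : 0 ≤ maxObjDist S := by
    obtain ⟨A, hA, B, hB, h⟩ := hobj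
    exact h.le.trans (le_csSup hbdd ⟨A, hA, B, hB, rfl⟩)
  have hLM : maxEdgeLen S ≤ maxObjDist S := by
    refine Real.sSup_le ?_ hM0
    rintro _ ⟨s, hs, i, rfl⟩
    refine le_csSup hbdd ⟨_, ⟨s, hs, Or.inl ⟨i.castSucc, rfl⟩⟩, _,
      ⟨s, hs, Or.inl ⟨i.succ, rfl⟩⟩, ?_⟩
    rw [setDist_singleton]
  -- the minimal Fréchet distance is attained
  have hδ : ∃ s ∈ S, ∃ s' ∈ S, s ≠ s' ∧
      frechetDist (curveMap s.2) (curveMap s'.2) = minFrechet S := by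
    have hfin : { r : ℝ | ∃ s ∈ S, ∃ s' ∈ S, s ≠ s' ∧
        frechetDist (curveMap s.2) (curveMap s'.2) = r }.Finite := by
      refine (S.finite_toSet.image2
        (fun s s' => frechetDist (curveMap s.2) (curveMap s'.2)) S.finite_toSet).subset ?_
      rintro r ⟨s, hs, s', hs', _, rfl⟩
      exact ⟨s, hs, s', hs', rfl⟩
    obtain ⟨s, hs, s', hs', hne⟩ := Finset.one_lt_card.1 hcard
    have hne' : { r : ℝ | ∃ s ∈ S, ∃ s' ∈ S, s ≠ s' ∧
        frechetDist (curveMap s.2) (curveMap s'.2) = r }.Nonempty :=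
      ⟨_, s, hs, s', hs', hne, rfl⟩
    exact hne'.csInf_mem hfin
  obtain ⟨s, hs, s', hs', hne, hδe⟩ := hδ
  have hδ0 := hpos s hs s' hs' hne
  have hle : minPosObjDist S ≤ 2 * minFrechet S := by
    by_contra hlt
    push Not at hlt
    rw [← hδe] at hlt
    have hnn : ∀ r ∈ { r : ℝ | ∃ f g : ℝ → ℝ, IsRepar f ∧ IsRepar g ∧
        ∀ t ∈ Icc (0 : ℝ) 1, dist (curveMap s.2 (f t)) (curveMap s'.2 (g t)) ≤ r }, 0 ≤ r := by
      rintro r ⟨f, g, _, _, h⟩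
      exact dist_nonneg.trans (h 0 (by simp))
    have hnonempty : { r : ℝ | ∃ f g : ℝ → ℝ, IsRepar f ∧ IsRepar g ∧
        ∀ t ∈ Icc (0 : ℝ) 1, dist (curveMap s.2 (f t)) (curveMap s'.2 (g t)) ≤ r }.Nonempty := by
      by_contra hemp
      rw [Set.not_nonempty_iff_eq_empty] at hemp
      rw [frechetDist, hemp, Real.sInf_empty] at hδ0
      exact lt_irrefl _ hδ0
    obtain ⟨r, hrmem, hr⟩ := exists_lt_of_csInf_lt hnonempty
      (show sInf _ < minPosObjDist S / 2 by
        have : frechetDist (curveMap s.2) (curveMap s'.2) < minPosObjDist S / 2 := by linarith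
        exact this)
    have hr0 := hnn r hrmem
    obtain ⟨f, g, hf, hg, hfg⟩ := hrmem
    obtain ⟨n, q, hP⟩ := exists_plData S s hs
    obtain ⟨n', q', hQ⟩ := exists_plData S s' hs'
    have h0 := frechet_zero (sep_objects S) hr0 (by linarith) hP hQ hf hg hfg
    have : frechetDist (curveMap s.2) (curveMap s'.2) ≤ 0 := csInf_le ⟨0, hnn⟩ h0
    linarith
  rw [hδe] at hδ0
  rw [spread, ← mul_div_assoc, div_le_div_iff₀ hδ0 hm]
  nlinarith [mul_le_mul_of_nonneg_left hle hM0, mul_le_mul_of_nonneg_right hLM hm.le]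
end
end
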